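/- arXiv:1304.3595 — 2 statements merged into one kernel-verified Lean document; each statement's English description precedes it below -/
import Mathlib

section
/- Let α ∈ (1,2) and let μ_α be the probability measure on ℝ with density proportional to e^{−|x|^α/α}. Then for every smooth compactly supported f : ℝ → ℝ, (α−1) · α^{1−2/α} · (Γ(1/α)/Γ((3−α)/α)) · Var_{μ_α}(f) ≤ ∫_ℝ f'(x)² dμ_α(x); equivalently, the spectral gap satisfies λ₁ ≥ (α−1)/∫_ℝ |x|^{2−α} dμ_α(x) = (α−1) α^{1−2/α} Γ(1/α)/Γ((3−α)/α). -/
open MeasureTheory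

/-- Normalization constant `Z_α = ∫ e^{−|x|^α/α} dx`. -/
noncomputable def Zalpha (α : ℝ) : ℝ := ∫ x : ℝ, Real.exp (-(|x| ^ α) / α)

/-- The probability measure `μ_α` with density `e^{−|x|^α/α}/Z_α`. -/
noncomputable def muAlpha (α : ℝ) : Measure ℝ :=
  volume.withDensity (fun x => ENNReal.ofReal (Real.exp (-(|x| ^ α) / α) / Zalpha α))

/-- The variance `Var_μ(f) = ∫ f² dμ − (∫ f dμ)²`. -/
noncomputable def varMu (μ : Measure ℝ) (f : ℝ → ℝ) : ℝ :=
  (∫ x, f x ^ 2 ∂μ) - (∫ x, f x ∂μ) ^ 2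

open Set

/-- Global existence for the planar linear system `u' = h`, `h' = W h - l u` on `[0, T]`. -/
theorem exists_hasDerivWithinAt_linear_system {W : ℝ → ℝ} (hW : Continuous W) (l : ℝ) {T : ℝ}
    (hT : 0 ≤ T) :
    ∃ u h : ℝ → ℝ, u 0 = 0 ∧ h 0 = 1 ∧ ∀ t ∈ Icc 0 T,
      HasDerivWithinAt u (h t) (Icc 0 T) t ∧
      HasDerivWithinAt h (W t * h t - l * u t) (Icc 0 T) t := by
  obtain ⟨C, hC⟩ := isCompact_Icc.exists_bound_of_continuousOn (hW.continuousOn (s := Icc 0 T))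
  have hC0 : 0 ≤ C := (norm_nonneg _).trans (hC 0 ⟨le_rfl, hT⟩)
  set K : ℝ := C + |l| + 1 with hK
  have hK0 : 0 ≤ K := by positivity
  set M : ℝ := Real.exp (K * T) with hM
  have hM1 : 1 ≤ M := Real.one_le_exp (by positivity)
  let c : ℝ → ℝ := fun y => max (-M) (min y M)
  have c_lip (y z : ℝ) : |c y - c z| ≤ |y - z| := by
    simp only [c, abs_le, max_def, min_def]
    constructor <;> split_ifs <;> cases abs_cases (y - z) <;> linarith
  have c_le (y : ℝ) : |c y| ≤ |y| := by
    have : c 0 = 0 := by simp only [c]; rw [min_eq_left, max_eq_right] <;> linarith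
    simpa [this] using c_lip y 0
  have c_M (y : ℝ) : |c y| ≤ M := by
    rw [abs_le]
    exact ⟨le_max_left _ _, max_le (by linarith) (min_le_right _ _)⟩
  have c_eq {y : ℝ} (hy : |y| ≤ M) : c y = y := by
    rw [abs_le] at hy
    simp [c, hy.1, hy.2]
  let v : ℝ → ℝ × ℝ → ℝ × ℝ := fun t y => (c y.2, W t * c y.2 - l * c y.1)
  have key {t a b s : ℝ} (ht : t ∈ Icc 0 T) (ha : |a| ≤ s) (hb : |b| ≤ s) :
      ‖((b, W t * b - l * a) : ℝ × ℝ)‖ ≤ K * s := by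
    have hs : 0 ≤ s := (abs_nonneg _).trans ha
    have hWt := hC t ht
    rw [Real.norm_eq_abs] at hWt
    have h1 : |W t * b| ≤ C * s := by rw [abs_mul]; gcongr
    have h2 : |l * a| ≤ |l| * s := by rw [abs_mul]; gcongr
    rw [Prod.norm_def]
    refine max_le ?_ ?_
    · simp only [Real.norm_eq_abs]
      nlinarith [mul_nonneg hC0 hs, mul_nonneg (abs_nonneg l) hs]
    · simp only [Real.norm_eq_abs]
      have := abs_sub (W t * b) (l * a)
      nlinarith
  have pl : IsPicardLindelof v (⟨0, le_rfl, hT⟩ : Icc (0 : ℝ) T) ((0, 1) : ℝ × ℝ)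
      (⟨K * M * T, by positivity⟩) 0 ⟨K * M, by positivity⟩ ⟨K, hK0⟩ := by
    refine ⟨fun t ht => ?_, fun x _ => ?_, fun t ht x _ => key ht (c_M _) (c_M _), ?_⟩
    · refine LipschitzOnWith.of_dist_le_mul fun y _ z _ => ?_
      rw [dist_eq_norm, dist_eq_norm]
      have : v t y - v t z = (c y.2 - c z.2, W t * (c y.2 - c z.2) - l * (c y.1 - c z.1)) := by
        ext <;> simp [v]
        ring
      rw [this]
      exact key ht ((c_lip _ _).trans (norm_fst_le (y - z))) ((c_lip _ _).trans (norm_snd_le (y - z)))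
    · simp only [v]
      fun_prop
    · simp only [sub_zero, sub_self, max_eq_left hT, NNReal.coe_zero]
      exact le_rfl
  obtain ⟨y, hy0, hy⟩ := pl.exists_eq_forall_mem_Icc_hasDerivWithinAt₀
  have hy0' : y 0 = (0, 1) := hy0
  have hbound : ∀ t ∈ Icc 0 T, ‖y t‖ ≤ M := by
    intro t ht
    have := norm_le_gronwallBound_of_norm_deriv_right_le (f := y) (f' := fun t => v t (y t))
      (δ := 1) (K := K) (ε := 0) (fun t ht => (hy t ht).continuousWithinAt)
      (fun t ht => ((hy t ⟨ht.1, ht.2.le⟩).mono_of_mem_nhdsWithin (Icc_mem_nhdsGE_of_mem ht)))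
      (by simp [hy0', Prod.norm_def])
      (fun t ht => by
        rw [add_zero]
        exact key ⟨ht.1, ht.2.le⟩ ((c_le _).trans (norm_fst_le (y t)))
          ((c_le _).trans (norm_snd_le (y t)))) t ht
    rw [gronwallBound_ε0, sub_zero, one_mul] at this
    refine this.trans (Real.exp_le_exp.2 ?_)
    gcongr
    exact ht.2
  refine ⟨fun t => (y t).1, fun t => (y t).2, by simp [hy0'], by simp [hy0'], fun t ht => ?_⟩
  have h1 := c_eq ((norm_fst_le (y t)).trans (hbound t ht))
  have h2 := c_eq ((norm_snd_le (y t)).trans (hbound t ht))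
  have hd := hy t ht
  simp only [v, h1, h2] at hd
  exact ⟨hd.fst, hd.snd⟩

/-- A weighted Hardy inequality on `[0, R]`: if `u' = h` and `(ρ h)' = -l ρ u` with `u 0 = 0`,
`u' 0 ≠ 0`, `u > 0` on `(0, R]` and `h R ≥ 0`, then every `g` vanishing at `0` satisfies
`l ∫ g² ρ ≤ ∫ g'² ρ`. -/
theorem mul_integral_sq_le_integral_deriv_sq {ρ W u h g g' : ℝ → ℝ} {l R : ℝ} (hR : 0 < R)
    (hρ : Continuous ρ) (hρ0 : ∀ x, 0 ≤ ρ x)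
    (hρ' : ∀ x, 0 < x → HasDerivAt ρ (-(W x * ρ x)) x)
    (hu0 : u 0 = 0) (hh0 : h 0 ≠ 0)
    (hu : ∀ x ∈ Icc 0 R, HasDerivWithinAt u (h x) (Icc 0 R) x)
    (hh : ∀ x ∈ Icc 0 R, HasDerivWithinAt h (W x * h x - l * u x) (Icc 0 R) x)
    (hpos : ∀ x ∈ Ioc 0 R, 0 < u x) (hhR : 0 ≤ h R)
    (hg0 : g 0 = 0) (hg : ∀ x ∈ Icc 0 R, HasDerivWithinAt g (g' x) (Icc 0 R) x)
    (hg' : ContinuousOn g' (Icc 0 R)) :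
    l * ∫ x in (0)..R, g x ^ 2 * ρ x ≤ ∫ x in (0)..R, g' x ^ 2 * ρ x := by
  have cu : ContinuousOn u (Icc 0 R) := fun x hx => (hu x hx).continuousWithinAt
  have ch : ContinuousOn h (Icc 0 R) := fun x hx => (hh x hx).continuousWithinAt
  have cg : ContinuousOn g (Icc 0 R) := fun x hx => (hg x hx).continuousWithinAt
  have h0mem : (0 : ℝ) ∈ Icc 0 R := ⟨le_rfl, hR.le⟩
  have cΨ : ContinuousOn (fun x => ρ x * h x * (g x * (g x / u x))) (Icc 0 R) := by
    refine (hρ.continuousOn.mul ch).mul ?_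
    intro x hx
    rcases hx.1.eq_or_lt with rfl | hx0
    · have h1 := (hasDerivWithinAt_iff_tendsto_slope.1 (hg 0 h0mem))
      have h2 := (hasDerivWithinAt_iff_tendsto_slope.1 (hu 0 h0mem))
      have h3 := ((cg 0 h0mem).mono sdiff_subset).tendsto.mul (h1.div h2 hh0)
      rw [hg0, zero_mul] at h3
      have h4 : ContinuousWithinAt (fun x => g x * (g x / u x)) (Icc 0 R \ {0}) 0 := by
        have : g 0 * (g 0 / u 0) = 0 := by rw [hg0, zero_mul]
        rw [ContinuousWithinAt, this]
        refine h3.congr' ?_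
        filter_upwards [self_mem_nhdsWithin] with y hy
        have hy0 : y ≠ 0 := hy.2
        simp only [slope_def_field, hg0, hu0, sub_zero, Pi.div_apply]
        rw [div_div_div_cancel_right₀ hy0]
      exact continuousWithinAt_sdiff_self.1 h4
    · exact (cg x hx).mul ((cg x hx).div (cu x hx) (hpos x ⟨hx0, hx.2⟩).ne')
  have cφ : ContinuousOn (fun x => g' x ^ 2 * ρ x - l * (g x ^ 2 * ρ x)) (Icc 0 R) :=
    ((hg'.pow 2).mul hρ.continuousOn).sub (continuousOn_const.mul ((cg.pow 2).mul hρ.continuousOn))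
  have main := intervalIntegral.sub_le_integral_of_hasDeriv_right_of_le
    (g' := fun x => ((-(W x * ρ x)) * h x + ρ x * (W x * h x - l * u x)) * (g x * (g x / u x)) +
      (ρ x * h x) * (g' x * (g x / u x) + g x * ((g' x * u x - g x * h x) / u x ^ 2))) hR.le cΨ
    (fun x hx => by
      have hn := Icc_mem_nhds hx.1 hx.2
      have hx' := Ioo_subset_Icc_self hx
      have dg := (hg x hx').hasDerivAt hn
      have du := (hu x hx').hasDerivAt hn
      have dh := (hh x hx').hasDerivAt hn
      exact (((hρ' x hx.1).mul dh).mul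
        (dg.mul (dg.div du (hpos x ⟨hx.1, hx.2.le⟩).ne'))).hasDerivWithinAt)
    cφ.integrableOn_Icc
    (fun x hx => by
      have hux := hpos x ⟨hx.1, hx.2.le⟩
      have : 0 ≤ ρ x * (g' x - g x * h x / u x) ^ 2 := mul_nonneg (hρ0 x) (sq_nonneg _)
      refine sub_nonneg.1 (this.trans_eq ?_)
      field_simp
      ring)
  have i1 : IntervalIntegrable (fun x => g' x ^ 2 * ρ x) volume 0 R :=
    ((hg'.pow 2).mul hρ.continuousOn).intervalIntegrable_of_Icc hR.le
  have i2 : IntervalIntegrable (fun x => g x ^ 2 * ρ x) volume 0 R :=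
    ((cg.pow 2).mul hρ.continuousOn).intervalIntegrable_of_Icc hR.le
  rw [intervalIntegral.integral_sub i1 (i2.const_mul l), intervalIntegral.integral_const_mul,
    hg0] at main
  have : 0 ≤ ρ R * h R * (g R * (g R / u R)) := by
    have := hpos R ⟨hR, le_rfl⟩
    have h1 : 0 ≤ g R * (g R / u R) := by rw [← mul_div_assoc]; exact div_nonneg (mul_self_nonneg _) this.le
    exact mul_nonneg (mul_nonneg (hρ0 R) hhR) h1
  linarith

theorem pos_of_hasDerivWithinAt_pos {u h : ℝ → ℝ} {R : ℝ} (hu0 : u 0 = 0)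
    (hu : ∀ x ∈ Icc 0 R, HasDerivWithinAt u (h x) (Icc 0 R) x) (hpos : ∀ x ∈ Ioo 0 R, 0 < h x) :
    ∀ x ∈ Ioc 0 R, 0 < u x := by
  have hmono : StrictMonoOn u (Icc 0 R) := by
    refine strictMonoOn_of_deriv_pos (convex_Icc _ _)
      (fun x hx => (hu x hx).continuousWithinAt) fun x hx => ?_
    rw [interior_Icc] at hx
    rw [((hu x (Ioo_subset_Icc_self hx)).hasDerivAt (Icc_mem_nhds hx.1 hx.2)).deriv]
    exact hpos x hx
  intro x hx
  rw [← hu0]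
  exact hmono ⟨le_rfl, hx.1.le.trans hx.2⟩ ⟨hx.1.le, hx.2⟩ hx.1

/-- The unnormalized density `e^{−|x|^α/α}`. -/
noncomputable def expWeight (α x : ℝ) : ℝ := Real.exp (-(|x| ^ α) / α)

theorem expWeight_pos (α x : ℝ) : 0 < expWeight α x := Real.exp_pos _

theorem expWeight_neg (α x : ℝ) : expWeight α (-x) = expWeight α x := by simp [expWeight]

theorem continuous_expWeight {α : ℝ} (hα : 0 < α) : Continuous (expWeight α) := by
  have : Continuous fun x : ℝ => |x| ^ α := continuous_abs.rpow_const fun _ => Or.inr hα.le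
  unfold expWeight
  fun_prop

theorem expWeight_of_nonneg {α x : ℝ} (hx : 0 ≤ x) :
    expWeight α x = Real.exp (-(1 / α) * x ^ α) := by
  rw [expWeight, abs_of_nonneg hx]
  congr 1
  ring

theorem hasDerivAt_expWeight {α x : ℝ} (hα : 0 < α) (hx : 0 < x) :
    HasDerivAt (expWeight α) (-(x ^ (α - 1) * expWeight α x)) x := by
  have h1 := (((Real.hasDerivAt_rpow_const (p := α) (Or.inl hx.ne')).const_mul (-(1 / α))).exp)
  refine (h1.congr_of_eventuallyEq ?_).congr_deriv ?_
  · filter_upwards [lt_mem_nhds hx] with y hy using expWeight_of_nonneg hy.le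
  · rw [expWeight_of_nonneg hx.le]
    field_simp

theorem integrableOn_rpow_mul_expWeight {α s : ℝ} (hα : 0 < α) (hs : -1 < s) :
    IntegrableOn (fun x => x ^ s * expWeight α x) (Ioi 0) :=
  (integrableOn_rpow_mul_exp_neg_mul_rpow hs hα (one_div_pos.2 hα)).congr_fun
    (fun _ hx => by simp only [expWeight_of_nonneg (le_of_lt hx)]) measurableSet_Ioi

theorem integrableOn_expWeight {α : ℝ} (hα : 0 < α) : IntegrableOn (expWeight α) (Ioi 0) := by
  simpa using integrableOn_rpow_mul_expWeight hα (neg_one_lt_zero)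

theorem integral_rpow_mul_expWeight {α s : ℝ} (hα : 0 < α) (hs : -1 < s) :
    ∫ x in Ioi (0 : ℝ), x ^ s * expWeight α x =
      (1 / α) ^ (-(s + 1) / α) * (1 / α) * Real.Gamma ((s + 1) / α) := by
  rw [← integral_rpow_mul_exp_neg_mul_rpow hα hs (one_div_pos.2 hα)]
  exact setIntegral_congr_fun measurableSet_Ioi
    fun _ hx => by simp only [expWeight_of_nonneg (le_of_lt hx)]

/-- The average of an increasing power over `[0, R]` is at most its average over `[0, ∞)`. -/
theorem intervalIntegral_rpow_mul_integral_le {α s R : ℝ} (hα : 0 < α) (hs : 0 ≤ s) (hR : 0 < R) :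
    (∫ x in (0)..R, x ^ s * expWeight α x) * ∫ x in Ioi 0, expWeight α x ≤
      (∫ x in Ioi 0, x ^ s * expWeight α x) * ∫ x in (0)..R, expWeight α x := by
  have iA := integrableOn_rpow_mul_expWeight (s := s) hα (by linarith)
  have iZ := integrableOn_expWeight hα
  have hsub : Ioi R ⊆ Ioi 0 := Ioi_subset_Ioi hR.le
  have cw := continuous_expWeight hα
  have cp : Continuous fun x : ℝ => x ^ s := Real.continuous_rpow_const hs
  rw [← intervalIntegral.integral_interval_add_Ioi iZ (iZ.mono_set hsub),
    ← intervalIntegral.integral_interval_add_Ioi iA (iA.mono_set hsub)]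
  have h1 : ∫ x in (0)..R, x ^ s * expWeight α x ≤ R ^ s * ∫ x in (0)..R, expWeight α x := by
    rw [← intervalIntegral.integral_const_mul]
    refine intervalIntegral.integral_mono_on hR.le ((cp.mul cw).intervalIntegrable _ _)
      ((cw.const_mul _).intervalIntegrable _ _) fun x hx => ?_
    exact mul_le_mul_of_nonneg_right (Real.rpow_le_rpow hx.1 hx.2 hs) (expWeight_pos _ _).le
  have h2 : R ^ s * ∫ x in Ioi R, expWeight α x ≤ ∫ x in Ioi R, x ^ s * expWeight α x := by
    rw [← integral_const_mul]
    refine setIntegral_mono_on ((iZ.mono_set hsub).const_mul _) (iA.mono_set hsub)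
      measurableSet_Ioi fun x hx => ?_
    exact mul_le_mul_of_nonneg_right (Real.rpow_le_rpow hR.le (le_of_lt hx) hs)
      (expWeight_pos _ _).le
  have h3 : 0 ≤ ∫ x in Ioi R, expWeight α x :=
    setIntegral_nonneg measurableSet_Ioi fun x _ => (expWeight_pos _ _).le
  have h4 : 0 ≤ ∫ x in (0)..R, expWeight α x :=
    intervalIntegral.integral_nonneg hR.le fun x _ => (expWeight_pos _ _).le
  nlinarith [mul_le_mul_of_nonneg_right h1 h3, mul_le_mul_of_nonneg_right h2 h4]

/-- If `(u, h)` solves the eigenvalue system on `[0, R]` and `h` vanishes for the first time at `R`,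
then the eigenvalue `l` satisfies the harmonic mean bound. -/
theorem harmonic_mean_bound_of_first_zero {α l R : ℝ} {u h : ℝ → ℝ} (hα₁ : 1 < α) (hα₂ : α < 2)
    (hl : 0 ≤ l) (hR : 0 < R) (hu0 : u 0 = 0) (hh0 : h 0 = 1)
    (hu : ∀ x ∈ Icc 0 R, HasDerivWithinAt u (h x) (Icc 0 R) x)
    (hh : ∀ x ∈ Icc 0 R, HasDerivWithinAt h (x ^ (α - 1) * h x - l * u x) (Icc 0 R) x)
    (hpos : ∀ x ∈ Ico 0 R, 0 < h x) (hhR : h R = 0) :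
    (α - 1) * ∫ x in Ioi 0, expWeight α x ≤ l * ∫ x in Ioi 0, x ^ (2 - α) * expWeight α x := by
  have hα : 0 < α := by linarith
  have hs : 0 < 2 - α := by linarith
  have cρ := continuous_expWeight hα
  have cu : ContinuousOn u (Icc 0 R) := fun x hx => (hu x hx).continuousWithinAt
  have ch : ContinuousOn h (Icc 0 R) := fun x hx => (hh x hx).continuousWithinAt
  have cW : Continuous fun x : ℝ => x ^ (α - 1) := Real.continuous_rpow_const (by linarith)
  have cp : Continuous fun x : ℝ => x ^ (2 - α) := Real.continuous_rpow_const hs.le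
  have ch' : ContinuousOn (fun x => x ^ (α - 1) * h x - l * u x) (Icc 0 R) :=
    (cW.continuousOn.mul ch).sub (continuousOn_const.mul cu)
  have hIcc : uIcc 0 R = Icc 0 R := uIcc_of_le hR.le
  set ρ := expWeight α with hρ
  have iZ : IntervalIntegrable ρ volume 0 R := cρ.intervalIntegrable _ _
  have iA : IntervalIntegrable (fun x => x ^ (2 - α) * ρ x) volume 0 R :=
    (cp.mul cρ).intervalIntegrable _ _
  have i1 : IntervalIntegrable (fun x => h x * ρ x) volume 0 R :=
    (ch.mul cρ.continuousOn).intervalIntegrable_of_Icc hR.le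
  have i2 : IntervalIntegrable (fun x => h x ^ 2 * ρ x) volume 0 R :=
    ((ch.pow 2).mul cρ.continuousOn).intervalIntegrable_of_Icc hR.le
  have iD : IntervalIntegrable (fun x => (x ^ (α - 1) * h x - l * u x) ^ 2 * ρ x) volume 0 R :=
    ((ch'.pow 2).mul cρ.continuousOn).intervalIntegrable_of_Icc hR.le
  have iP : IntervalIntegrable (fun x => x ^ (α - 2) * (h x ^ 2 * ρ x)) volume 0 R :=
    (intervalIntegral.intervalIntegrable_rpow' (by linarith)).mul_continuousOn
      (hIcc ▸ (ch.pow 2).mul cρ.continuousOn)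
  have poincare := mul_integral_sq_le_integral_deriv_sq (g := fun x => h x - 1) hR cρ
    (fun x => (expWeight_pos α x).le) (fun x hx => hasDerivAt_expWeight hα hx) hu0
    (by rw [hh0]; exact one_ne_zero) hu hh
    (pos_of_hasDerivWithinAt_pos hu0 hu fun x hx => hpos x (Ioo_subset_Ico_self hx)) hhR.ge (by simp [hh0])
    (fun x hx => (hh x hx).sub_const 1) ch'
  have bochner : (∫ x in (0)..R, (x ^ (α - 1) * h x - l * u x) ^ 2 * ρ x) +
      (α - 1) * (∫ x in (0)..R, x ^ (α - 2) * (h x ^ 2 * ρ x)) -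
      l * (∫ x in (0)..R, h x ^ 2 * ρ x) = 0 := by
    rw [← intervalIntegral.integral_const_mul, ← intervalIntegral.integral_const_mul,
      ← intervalIntegral.integral_add iD (iP.const_mul _),
      ← intervalIntegral.integral_sub (iD.add (iP.const_mul _)) (i2.const_mul _)]
    have := intervalIntegral.integral_eq_sub_of_hasDerivAt_of_le
      (f := fun x => ρ x * h x * (x ^ (α - 1) * h x - l * u x))
      (f' := fun x => (x ^ (α - 1) * h x - l * u x) ^ 2 * ρ x +
        (α - 1) * (x ^ (α - 2) * (h x ^ 2 * ρ x)) - l * (h x ^ 2 * ρ x)) hR.le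
      ((cρ.continuousOn.mul ch).mul ch') (fun x hx => by
        have hn := Icc_mem_nhds hx.1 hx.2
        have hx' := Ioo_subset_Icc_self hx
        have du := (hu x hx').hasDerivAt hn
        have dh := (hh x hx').hasDerivAt hn
        have dp := Real.hasDerivAt_rpow_const (x := x) (p := α - 1) (Or.inl hx.1.ne')
        refine (((hasDerivAt_expWeight hα hx.1).mul dh).mul
          ((dp.mul dh).sub (du.const_mul l))).congr_deriv ?_
        rw [show α - 1 - 1 = α - 2 by ring]
        simp only [Pi.mul_apply, Pi.sub_apply, ← hρ]
        ring) ((iD.add (iP.const_mul _)).sub (i2.const_mul _))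
    rw [this, hhR, hu0, Real.zero_rpow (by linarith)]
    ring
  have expand : ∫ x in (0)..R, (h x - 1) ^ 2 * ρ x =
      (∫ x in (0)..R, h x ^ 2 * ρ x) - 2 * (∫ x in (0)..R, h x * ρ x) + ∫ x in (0)..R, ρ x := by
    rw [← intervalIntegral.integral_const_mul, ← intervalIntegral.integral_sub i2 (i1.const_mul _),
      ← intervalIntegral.integral_add (i2.sub (i1.const_mul _)) iZ]
    exact intervalIntegral.integral_congr fun x _ => by ring
  have schwarz (t : ℝ) : 0 ≤ (∫ x in (0)..R, x ^ (α - 2) * (h x ^ 2 * ρ x)) -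
      2 * t * (∫ x in (0)..R, h x * ρ x) + t ^ 2 * ∫ x in (0)..R, x ^ (2 - α) * ρ x := by
    rw [← intervalIntegral.integral_const_mul, ← intervalIntegral.integral_const_mul,
      ← intervalIntegral.integral_sub iP (i1.const_mul _),
      ← intervalIntegral.integral_add (iP.sub (i1.const_mul _)) (iA.const_mul _)]
    refine intervalIntegral.integral_nonneg_of_ae_restrict hR.le ?_
    rw [← Measure.restrict_congr_set Ioc_ae_eq_Icc]
    filter_upwards [ae_restrict_mem measurableSet_Ioc] with x hx
    have e : x ^ (α - 2) * x ^ (2 - α) = 1 := by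
      rw [← Real.rpow_add hx.1]; simp
    have : 0 ≤ x ^ (α - 2) * ρ x * (h x - t * x ^ (2 - α)) ^ 2 :=
      mul_nonneg (mul_nonneg (Real.rpow_nonneg hx.1.le _) (expWeight_pos α x).le) (sq_nonneg _)
    refine this.trans_eq ?_
    linear_combination (-2 * t * h x * ρ x + t ^ 2 * x ^ (2 - α) * ρ x) * e
  have avg := intervalIntegral_rpow_mul_integral_le (α := α) hα hs.le hR
  have pZ : 0 < ∫ x in (0)..R, ρ x :=
    intervalIntegral.intervalIntegral_pos_of_pos iZ (fun x => expWeight_pos α x) hR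
  have pA : 0 < ∫ x in (0)..R, x ^ (2 - α) * ρ x :=
    intervalIntegral.intervalIntegral_pos_of_pos_on iA
      (fun x hx => mul_pos (Real.rpow_pos_of_pos hx.1 _) (expWeight_pos α x)) hR
  have p1 : 0 < ∫ x in (0)..R, h x * ρ x :=
    intervalIntegral.intervalIntegral_pos_of_pos_on i1
      (fun x hx => mul_pos (hpos x (Ioo_subset_Ico_self hx)) (expWeight_pos α x)) hR
  have pZZ : 0 ≤ ∫ x in Ioi 0, ρ x :=
    setIntegral_nonneg measurableSet_Ioi fun x _ => (expWeight_pos α x).le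
  rw [expand] at poincare
  set Z := ∫ x in (0)..R, ρ x
  set A := ∫ x in (0)..R, x ^ (2 - α) * ρ x
  set H := ∫ x in (0)..R, h x * ρ x
  set H2 := ∫ x in (0)..R, h x ^ 2 * ρ x
  set P := ∫ x in (0)..R, x ^ (α - 2) * (h x ^ 2 * ρ x)
  have hP : H ^ 2 ≤ P * A := by
    have := mul_nonneg (schwarz (H / A)) pA.le
    have e : (P - 2 * (H / A) * H + (H / A) ^ 2 * A) * A = P * A - H ^ 2 := by
      field_simp
      ring
    linarith
  have hZP : Z * ((α - 1) * P) ≤ l * H ^ 2 := by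
    have h1 : (α - 1) * P ≤ l * (2 * H - Z) := by linarith
    nlinarith [mul_le_mul_of_nonneg_left h1 pZ.le, mul_nonneg hl (sq_nonneg (H - Z))]
  have hZA : (α - 1) * Z ≤ l * A := by
    have h1 : H ^ 2 * ((α - 1) * Z) ≤ H ^ 2 * (l * A) := by
      nlinarith [mul_le_mul_of_nonneg_left hP (mul_nonneg (sub_nonneg.2 hα₁.le) pZ.le),
        mul_le_mul_of_nonneg_right hZP pA.le]
    exact le_of_mul_le_mul_left h1 (by positivity)
  have h1 := mul_le_mul_of_nonneg_right hZA pZZ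
  have h2 := mul_le_mul_of_nonneg_left avg hl
  refine le_of_mul_le_mul_right ?_ pZ
  linarith

theorem mul_intervalIntegral_sq_sub_le {α l R : ℝ} {f f' : ℝ → ℝ} (hα₁ : 1 < α) (hα₂ : α < 2)
    (hl : 0 ≤ l) (hR : 0 < R)
    (hlt : l * ∫ x in Ioi 0, x ^ (2 - α) * expWeight α x < (α - 1) * ∫ x in Ioi 0, expWeight α x)
    (hf : ∀ x, HasDerivAt f (f' x) x) (hf' : Continuous f') :
    l * ∫ x in (0)..R, (f x - f 0) ^ 2 * expWeight α x ≤
      ∫ x in (0)..R, f' x ^ 2 * expWeight α x := by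
  obtain ⟨u, h, hu0, hh0, hsys⟩ := exists_hasDerivWithinAt_linear_system
    (W := fun x => x ^ (α - 1)) (Real.continuous_rpow_const (by linarith)) l hR.le
  have ch : ContinuousOn h (Icc 0 R) := fun x hx => (hsys x hx).2.continuousWithinAt
  have hpos : ∀ x ∈ Icc 0 R, 0 < h x := by
    by_contra! hneg
    set S : Set ℝ := Icc 0 R ∩ h ⁻¹' Iic 0 with hS
    have hScl : IsClosed S := ch.preimage_isClosed_of_isClosed isClosed_Icc isClosed_Iic
    have hSne : S.Nonempty := let ⟨x, hx, hx'⟩ := hneg; ⟨x, hx, hx'⟩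
    have hSbdd : BddBelow S := ⟨0, fun x hx => hx.1.1⟩
    obtain ⟨hr, hr'⟩ : sInf S ∈ S := hScl.csInf_mem hSne hSbdd
    set r := sInf S
    have hlow : ∀ x ∈ Ico 0 r, 0 < h x := fun x hx => by
      by_contra! hx'
      exact (csInf_le hSbdd (show x ∈ S from ⟨⟨hx.1, hx.2.le.trans hr.2⟩, hx'⟩)).not_gt hx.2
    have hr0 : 0 < r := by
      refine hr.1.lt_of_ne fun e => ?_
      rw [mem_preimage, mem_Iic, ← e, hh0] at hr'
      exact absurd hr' (by norm_num)
    have hsub : Icc 0 r ⊆ Icc 0 R := Icc_subset_Icc_right hr.2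
    have hhr : h r = 0 := by
      refine le_antisymm hr' ?_
      have hc : ContinuousWithinAt h (Ico 0 r) r :=
        (ch r hr).mono (Ico_subset_Icc_self.trans hsub)
      have hcl : r ∈ closure (Ico 0 r) := by
        rw [closure_Ico hr0.ne]
        exact ⟨hr.1, le_rfl⟩
      exact ContinuousWithinAt.closure_le hcl continuousWithinAt_const hc fun x hx => (hlow x hx).le
    exact (harmonic_mean_bound_of_first_zero hα₁ hα₂ hl hr0 hu0 hh0
      (fun x hx => (hsys x (hsub hx)).1.mono hsub) (fun x hx => (hsys x (hsub hx)).2.mono hsub)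
      hlow hhr).not_gt hlt
  exact mul_integral_sq_le_integral_deriv_sq (g := fun x => f x - f 0) hR
    (continuous_expWeight (by linarith)) (fun x => (expWeight_pos α x).le)
    (fun x hx => hasDerivAt_expWeight (by linarith) hx) hu0
    (by rw [hh0]; exact one_ne_zero) (fun x hx => (hsys x hx).1) (fun x hx => (hsys x hx).2)
    (pos_of_hasDerivWithinAt_pos hu0 (fun x hx => (hsys x hx).1)
      fun x hx => hpos x (Ioo_subset_Icc_self hx)) (hpos R ⟨hR.le, le_rfl⟩).le (sub_self _)
    (fun x _ => ((hf x).sub_const _).hasDerivWithinAt) hf'.continuousOn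

theorem integrable_expWeight {α : ℝ} (hα : 0 < α) : Integrable (expWeight α) := by
  rw [← integrableOn_univ, ← Iic_union_Ioi (a := (0 : ℝ)), integrableOn_union]
  refine ⟨?_, integrableOn_expWeight hα⟩
  have h := (integrableOn_Ici_iff_integrableOn_Ioi (b := (0 : ℝ))).2 (integrableOn_expWeight hα)
  rw [← neg_zero] at h
  simpa only [expWeight_neg] using h.comp_neg_Iic

/-- The half-line inequality with the optimal constant in the harmonic mean bound. -/
theorem mul_integral_Ioi_sq_sub_le {α : ℝ} {f f' : ℝ → ℝ} (hα₁ : 1 < α) (hα₂ : α < 2)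
    (hf : ∀ x, HasDerivAt f (f' x) x) (hf' : Continuous f') {C : ℝ} (hfC : ∀ x, |f x| ≤ C)
    (hf'C : ∀ x, |f' x| ≤ C) :
    (α - 1) * (∫ x in Ioi 0, expWeight α x) / (∫ x in Ioi 0, x ^ (2 - α) * expWeight α x) *
      ∫ x in Ioi 0, (f x - f 0) ^ 2 * expWeight α x ≤ ∫ x in Ioi 0, f' x ^ 2 * expWeight α x := by
  have hα : 0 < α := by linarith
  have cf : Continuous f := continuous_iff_continuousAt.2 fun x => (hf x).continuousAt
  have iZ := integrableOn_expWeight hα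
  have i1 : IntegrableOn (fun x => (f x - f 0) ^ 2 * expWeight α x) (Ioi 0) := by
    refine iZ.bdd_mul (c := (2 * C) ^ 2) (by fun_prop) (Filter.Eventually.of_forall fun x => ?_)
    rw [norm_pow, Real.norm_eq_abs]
    have h1 := abs_sub (f x) (f 0)
    have h2 := hfC x
    have h3 := hfC 0
    gcongr
    linarith
  have i2 : IntegrableOn (fun x => f' x ^ 2 * expWeight α x) (Ioi 0) := by
    refine iZ.bdd_mul (c := C ^ 2) (by fun_prop) (Filter.Eventually.of_forall fun x => ?_)
    rw [norm_pow, Real.norm_eq_abs]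
    have := hf'C x
    gcongr
  have hA : 0 < ∫ x in Ioi 0, x ^ (2 - α) * expWeight α x := by
    rw [integral_rpow_mul_expWeight hα (by linarith)]
    have := Real.Gamma_pos_of_pos (s := (2 - α + 1) / α) (div_pos (by linarith) hα)
    positivity
  have hI : 0 ≤ ∫ x in Ioi 0, (f x - f 0) ^ 2 * expWeight α x :=
    setIntegral_nonneg measurableSet_Ioi fun x _ =>
      mul_nonneg (sq_nonneg _) (expWeight_pos _ _).le
  have hJ : 0 ≤ ∫ x in Ioi 0, f' x ^ 2 * expWeight α x :=
    setIntegral_nonneg measurableSet_Ioi fun x _ =>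
      mul_nonneg (sq_nonneg _) (expWeight_pos _ _).le
  have sub (l : ℝ) (hl : 0 ≤ l) (hlt : l < (α - 1) * (∫ x in Ioi 0, expWeight α x) /
      (∫ x in Ioi 0, x ^ (2 - α) * expWeight α x)) :
      l * ∫ x in Ioi 0, (f x - f 0) ^ 2 * expWeight α x ≤
        ∫ x in Ioi 0, f' x ^ 2 * expWeight α x := by
    rw [lt_div_iff₀ hA] at hlt
    refine le_of_tendsto_of_tendsto
      ((intervalIntegral_tendsto_integral_Ioi 0 i1 Filter.tendsto_id).const_mul l)
      (intervalIntegral_tendsto_integral_Ioi 0 i2 Filter.tendsto_id) ?_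
    filter_upwards [Filter.eventually_gt_atTop 0] with R hR
    exact mul_intervalIntegral_sq_sub_le hα₁ hα₂ hl hR hlt hf hf'
  set κ := (α - 1) * (∫ x in Ioi 0, expWeight α x) / (∫ x in Ioi 0, x ^ (2 - α) * expWeight α x)
  set I := ∫ x in Ioi 0, (f x - f 0) ^ 2 * expWeight α x
  set J := ∫ x in Ioi 0, f' x ^ 2 * expWeight α x
  by_contra! hlt
  have hIpos : 0 < I := hI.lt_of_ne fun e => by rw [← e] at hlt; linarith
  have h1 : J / I < κ := (div_lt_iff₀ hIpos).2 hlt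
  obtain ⟨l, hl1, hl2⟩ := exists_between h1
  exact (sub l ((div_nonneg hJ hI).trans hl1.le) hl2).not_gt ((div_lt_iff₀ hIpos).1 hl1)

theorem integral_eq_integral_Ioi_add_comp_neg {g : ℝ → ℝ} (hg : Integrable g) :
    ∫ x, g x = (∫ x in Ioi 0, g x) + ∫ x in Ioi 0, g (-x) := by
  rw [integral_comp_neg_Ioi, neg_zero, add_comm,
    intervalIntegral.integral_Iic_add_Ioi hg.integrableOn hg.integrableOn]

theorem integral_muAlpha {α : ℝ} (hα : 0 < α) (g : ℝ → ℝ) :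
    ∫ x, g x ∂(muAlpha α) = (∫ x, g x * expWeight α x) / ∫ x, expWeight α x := by
  have hZ : 0 ≤ Zalpha α := integral_nonneg fun x => (Real.exp_pos _).le
  have cρ := continuous_expWeight hα
  unfold muAlpha
  rw [integral_withDensity_eq_integral_toReal_smul, ← integral_div]
  · refine integral_congr_ae (Filter.Eventually.of_forall fun x => ?_)
    simp only [smul_eq_mul]
    rw [ENNReal.toReal_ofReal (div_nonneg (Real.exp_pos _).le hZ)]
    change expWeight α x / (∫ x, expWeight α x) * g x = _
    ring
  · exact (cρ.measurable.div_const _).ennreal_ofReal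
  · exact Filter.Eventually.of_forall fun x => ENNReal.ofReal_lt_top

theorem integral_expWeight_pos {α : ℝ} (hα : 0 < α) : 0 < ∫ x, expWeight α x :=
  integral_exp_pos (integrable_expWeight hα)

theorem integral_expWeight {α : ℝ} (hα : 0 < α) :
    ∫ x, expWeight α x = 2 * ∫ x in Ioi 0, expWeight α x := by
  rw [integral_eq_integral_Ioi_add_comp_neg (integrable_expWeight hα)]
  simp only [expWeight_neg]
  ring

theorem integral_abs_rpow_muAlpha {α s : ℝ} (hα : 0 < α) :
    ∫ x, |x| ^ s ∂(muAlpha α) =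
      (∫ x in Ioi 0, x ^ s * expWeight α x) / ∫ x in Ioi 0, expWeight α x := by
  rw [integral_muAlpha hα, integral_expWeight hα]
  have : ∫ x, |x| ^ s * expWeight α x = 2 * ∫ x in Ioi 0, x ^ s * expWeight α x := by
    rw [← integral_comp_abs]
    simp [expWeight]
  rw [this, mul_div_mul_left _ _ two_ne_zero]

theorem varMu_muAlpha_le {α : ℝ} (hα : 0 < α) {f : ℝ → ℝ} (hf : Continuous f) {C : ℝ}
    (hfC : ∀ x, |f x| ≤ C) (c : ℝ) :
    varMu (muAlpha α) f ≤ ∫ x, (f x - c) ^ 2 ∂(muAlpha α) := by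
  have iZ := integrable_expWeight hα
  have i1 : Integrable fun x => f x * expWeight α x :=
    iZ.bdd_mul (c := C) hf.aestronglyMeasurable (Filter.Eventually.of_forall hfC)
  have i2 : Integrable fun x => f x ^ 2 * expWeight α x := by
    refine iZ.bdd_mul (c := C ^ 2) (by fun_prop) (Filter.Eventually.of_forall fun x => ?_)
    rw [norm_pow, Real.norm_eq_abs]
    have := hfC x
    gcongr
  have expand : ∫ x, (f x - c) ^ 2 * expWeight α x = (∫ x, f x ^ 2 * expWeight α x) -
      2 * c * (∫ x, f x * expWeight α x) + c ^ 2 * ∫ x, expWeight α x := by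
    rw [← integral_const_mul, ← integral_const_mul, ← integral_sub i2 (i1.const_mul _)]
    refine Eq.trans ?_ (integral_add (i2.sub (i1.const_mul _)) (iZ.const_mul _))
    exact integral_congr_ae (Filter.Eventually.of_forall fun x => by
      dsimp only
      ring)
  have hZ := integral_expWeight_pos hα
  rw [varMu, integral_muAlpha hα, integral_muAlpha hα, integral_muAlpha hα, expand, ← sub_nonneg]
  refine (sq_nonneg ((∫ x, f x * expWeight α x) / (∫ x, expWeight α x) - c)).trans_eq ?_
  field_simp
  ring

theorem mul_varMu_le {α : ℝ} (hα₁ : 1 < α) (hα₂ : α < 2) {f : ℝ → ℝ}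
    (hf : ContDiff ℝ 1 f) (hfc : HasCompactSupport f) :
    (α - 1) / (∫ x, |x| ^ (2 - α) ∂(muAlpha α)) * varMu (muAlpha α) f ≤
      ∫ x, deriv f x ^ 2 ∂(muAlpha α) := by
  have hα : 0 < α := by linarith
  have cf : Continuous f := hf.continuous
  have cf' : Continuous (deriv f) := hf.continuous_deriv le_rfl
  have df (x : ℝ) : HasDerivAt f (deriv f x) x :=
    (hf.differentiable one_ne_zero x).hasDerivAt
  obtain ⟨C₁, hC₁⟩ := hfc.exists_bound_of_continuous cf
  obtain ⟨C₂, hC₂⟩ := hfc.deriv.exists_bound_of_continuous cf'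
  have iZ := integrable_expWeight hα
  have i1 : Integrable fun x => (f x - f 0) ^ 2 * expWeight α x := by
    refine iZ.bdd_mul (c := (C₁ + C₁) ^ 2) (by fun_prop) (Filter.Eventually.of_forall fun x => ?_)
    rw [norm_pow]
    have := norm_sub_le_of_le (hC₁ x) (hC₁ 0)
    gcongr
  have i2 : Integrable fun x => deriv f x ^ 2 * expWeight α x := by
    refine iZ.bdd_mul (c := C₂ ^ 2) (by fun_prop) (Filter.Eventually.of_forall fun x => ?_)
    rw [norm_pow]
    have := hC₂ x
    gcongr
  have right := mul_integral_Ioi_sq_sub_le (C := max C₁ C₂) hα₁ hα₂ df cf'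
    (fun x => (hC₁ x).trans (le_max_left _ _)) (fun x => (hC₂ x).trans (le_max_right _ _))
  have left := mul_integral_Ioi_sq_sub_le (f := fun x => f (-x)) (f' := fun x => -deriv f (-x))
    (C := max C₁ C₂) hα₁ hα₂
    (fun x => ((df (-x)).comp x (hasDerivAt_neg x)).congr_deriv (mul_neg_one _)) (by fun_prop)
    (fun x => (hC₁ _).trans (le_max_left _ _))
    (fun x => by rw [abs_neg]; exact (hC₂ _).trans (le_max_right _ _))
  have hZ := integral_expWeight_pos hα
  have hκ : 0 ≤ (α - 1) / (∫ x, |x| ^ (2 - α) ∂(muAlpha α)) :=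
    div_nonneg (by linarith) (integral_nonneg fun x => by positivity)
  refine (mul_le_mul_of_nonneg_left (varMu_muAlpha_le hα cf hC₁ (f 0)) hκ).trans ?_
  rw [integral_abs_rpow_muAlpha hα, integral_muAlpha hα, integral_muAlpha hα, ← mul_div_assoc,
    integral_eq_integral_Ioi_add_comp_neg i1, integral_eq_integral_Ioi_add_comp_neg i2]
  refine div_le_div_of_nonneg_right ?_ hZ.le
  simp only [neg_zero, neg_sq] at left
  simp only [expWeight_neg]
  rw [div_div_eq_mul_div, mul_add]
  exact add_le_add right left

theorem div_integral_abs_rpow_muAlpha {α : ℝ} (hα₁ : 1 < α) (hα₂ : α < 2) :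
    (α - 1) / (∫ x, |x| ^ (2 - α) ∂(muAlpha α)) =
      (α - 1) * α ^ (1 - 2 / α) * (Real.Gamma (1 / α) / Real.Gamma ((3 - α) / α)) := by
  have hα : 0 < α := by linarith
  have hZ : ∫ x in Ioi 0, expWeight α x = α ^ (1 / α) * (1 / α) * Real.Gamma (1 / α) := by
    have := integral_rpow_mul_expWeight (s := 0) hα neg_one_lt_zero
    simp only [Real.rpow_zero, one_mul, zero_add] at this
    rw [this, one_div α, Real.inv_rpow hα.le, ← Real.rpow_neg hα.le]
    congr 3
    ring
  have hA : ∫ x in Ioi 0, x ^ (2 - α) * expWeight α x =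
      α ^ ((3 - α) / α) * (1 / α) * Real.Gamma ((3 - α) / α) := by
    rw [integral_rpow_mul_expWeight hα (by linarith), show 2 - α + 1 = 3 - α by ring, one_div α,
      Real.inv_rpow hα.le, ← Real.rpow_neg hα.le]
    congr 3
    ring
  have e : α ^ (1 / α) = α ^ (1 - 2 / α) * α ^ ((3 - α) / α) := by
    rw [← Real.rpow_add hα]
    congr 1
    field_simp
    ring
  have hΓ : Real.Gamma ((3 - α) / α) ≠ 0 :=
    (Real.Gamma_pos_of_pos (div_pos (by linarith) hα)).ne'
  have hp : α ^ ((3 - α) / α) ≠ 0 := (Real.rpow_pos_of_pos hα _).ne'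
  rw [integral_abs_rpow_muAlpha hα, hZ, hA, e]
  field_simp

/-- For `α ∈ (1,2)`, the spectral gap of `μ_α` satisfies
`λ₁ ≥ (α−1)/∫|x|^{2−α}dμ_α = (α−1) α^{1−2/α} Γ(1/α)/Γ((3−α)/α)`. -/
theorem spectral_gap_lower_bound_exponential_power (α : ℝ) (hα₁ : 1 < α) (hα₂ : α < 2) :
    (∀ f : ℝ → ℝ, ContDiff ℝ (⊤ : ℕ∞) f → HasCompactSupport f →
      (α - 1) * α ^ (1 - 2 / α) * (Real.Gamma (1 / α) / Real.Gamma ((3 - α) / α)) *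
          varMu (muAlpha α) f
        ≤ ∫ x, deriv f x ^ 2 ∂(muAlpha α))
    ∧ (α - 1) / (∫ x, |x| ^ (2 - α) ∂(muAlpha α))
        = (α - 1) * α ^ (1 - 2 / α) * (Real.Gamma (1 / α) / Real.Gamma ((3 - α) / α)) := by
  refine ⟨fun f hf hfc => ?_, div_integral_abs_rpow_muAlpha hα₁ hα₂⟩
  rw [← div_integral_abs_rpow_muAlpha hα₁ hα₂]
  exact mul_varMu_le hα₁ hα₂ (hf.of_le (by exact_mod_cast le_top)) hfc
end

section
/- (Generalized Cauchy measures.) Let β > 3/2 and let μ_β be the probability measure on ℝ with density (1 + x²)^{−β}/Z_β, where Z_β = Γ(1/2)Γ(β − 1/2)/Γ(β). Then for every smooth compactly supported f : ℝ → ℝ, the weighted Poincaré inequality ((2β − 1)(β − 3/2)/(β − 1)) · Var_{μ_β}(f) ≤ ∫_ℝ (1 + x²) f'(x)² dμ_β(x) holds; equivalently, for the diffusion with σ(x) = √(1+x²) reversible with respect to μ_β, the potential V_σ(x) = (2β − 1)/(1 + x²) is positive and the spectral gap satisfies λ₁ ≥ 1/∫ (1/V_σ) dμ_β = (2β−1)(β−3/2)/(β−1).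 -/
open MeasureTheory

/-- Normalization constant `Z_β = Γ(1/2)Γ(β−1/2)/Γ(β)` of the generalized Cauchy
measure. -/
noncomputable def Zcauchy (β : ℝ) : ℝ :=
  Real.Gamma (1 / 2) * Real.Gamma (β - 1 / 2) / Real.Gamma β

/-- The generalized Cauchy probability measure with density `(1+x²)^{−β}/Z_β`. -/
noncomputable def muCauchy (β : ℝ) : Measure ℝ :=
  volume.withDensity (fun x => ENNReal.ofReal ((1 + x ^ 2) ^ (-β) / Zcauchy β))

theorem integrable_one_add_sq_rpow_neg {a : ℝ} (ha : 1 / 2 < a) :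
    Integrable (fun x : ℝ => (1 + x ^ 2) ^ (-a)) := by
  have h := integrable_rpow_neg_one_add_norm_sq (E := ℝ) (μ := volume) (r := 2 * a)
    (by simp only [Module.finrank_self, Nat.cast_one]; linarith)
  refine h.congr (Filter.Eventually.of_forall fun x => ?_)
  simp only [Real.norm_eq_abs, sq_abs]
  congr 1
  ring

theorem integral_rpow_mul_exp_neg_one_add_sq_mul (β : ℝ) {t : ℝ} (ht : 0 < t) :
    ∫ x : ℝ, t ^ (β - 1) * Real.exp (-((1 + x ^ 2) * t))
      = √Real.pi * (t ^ (β - 1 / 2 - 1) * Real.exp (-(1 * t))) := by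
  have h : ∀ x : ℝ, t ^ (β - 1) * Real.exp (-((1 + x ^ 2) * t))
      = t ^ (β - 1) * Real.exp (-t) * Real.exp (-t * x ^ 2) := by
    intro x
    rw [mul_assoc, ← Real.exp_add]
    ring_nf
  simp_rw [h]
  rw [integral_const_mul, integral_gaussian, Real.sqrt_div Real.pi_pos.le,
    show β - 1 / 2 - 1 = (β - 1) - 1 / 2 by ring, Real.rpow_sub ht (β - 1) (1 / 2),
    ← Real.sqrt_eq_rpow, one_mul]
  ring

theorem integral_one_add_sq_rpow_neg {β : ℝ} (hβ : 1 / 2 < β) :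
    ∫ x : ℝ, (1 + x ^ 2) ^ (-β) = Zcauchy β := by
  have hβ0 : 0 < β := by linarith
  have hswap : ∫ x : ℝ, ∫ t in Set.Ioi (0 : ℝ), t ^ (β - 1) * Real.exp (-((1 + x ^ 2) * t))
      = ∫ t in Set.Ioi (0 : ℝ), ∫ x : ℝ, t ^ (β - 1) * Real.exp (-((1 + x ^ 2) * t)) := by
    apply integral_integral_swap
    rw [integrable_prod_iff']
    · constructor
      · filter_upwards [ae_restrict_mem measurableSet_Ioi] with t ht
        have ht' : (0 : ℝ) < t := ht
        have h := ((integrable_exp_neg_mul_sq ht').const_mul (t ^ (β - 1) * Real.exp (-t)))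
        refine h.congr (Filter.Eventually.of_forall fun x => ?_)
        simp only [Function.uncurry_apply_pair]
        rw [mul_assoc, ← Real.exp_add]
        ring_nf
      · have h : IntegrableOn (fun t : ℝ => √Real.pi * (Real.exp (-t) * t ^ (β - 1 / 2 - 1)))
            (Set.Ioi 0) :=
          (Real.GammaIntegral_convergent (by linarith : 0 < β - 1 / 2)).const_mul _
        refine h.congr ?_
        filter_upwards [ae_restrict_mem measurableSet_Ioi] with t ht
        have ht' : (0 : ℝ) < t := ht
        have hn : ∀ x : ℝ, ‖t ^ (β - 1) * Real.exp (-((1 + x ^ 2) * t))‖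
            = t ^ (β - 1) * Real.exp (-((1 + x ^ 2) * t)) :=
          fun x => Real.norm_of_nonneg (by positivity)
        simp only [Function.uncurry_apply_pair, hn]
        rw [integral_rpow_mul_exp_neg_one_add_sq_mul β ht', one_mul]
        ring
    · apply Measurable.aestronglyMeasurable
      simp only [Function.uncurry_def]
      fun_prop
  have hleft : ∀ x : ℝ, ∫ t in Set.Ioi (0 : ℝ), t ^ (β - 1) * Real.exp (-((1 + x ^ 2) * t))
      = (1 + x ^ 2) ^ (-β) * Real.Gamma β := by
    intro x
    rw [Real.integral_rpow_mul_exp_neg_mul_Ioi hβ0 (by positivity), one_div,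
      Real.inv_rpow (by positivity), Real.rpow_neg (by positivity)]
  have hright : ∫ t in Set.Ioi (0 : ℝ), ∫ x : ℝ, t ^ (β - 1) * Real.exp (-((1 + x ^ 2) * t))
      = √Real.pi * Real.Gamma (β - 1 / 2) := by
    rw [setIntegral_congr_fun measurableSet_Ioi
      (fun t ht => integral_rpow_mul_exp_neg_one_add_sq_mul β ht), integral_const_mul,
      Real.integral_rpow_mul_exp_neg_mul_Ioi (by linarith) one_pos]
    simp
  simp_rw [hleft] at hswap
  rw [hright, integral_mul_const] at hswap
  rw [Zcauchy, Real.Gamma_one_half_eq, eq_div_iff (Real.Gamma_pos_of_pos hβ0).ne', hswap]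

theorem Zcauchy_pos {β : ℝ} (hβ : 1 / 2 < β) : 0 < Zcauchy β :=
  div_pos (mul_pos (Real.Gamma_pos_of_pos (by norm_num)) (Real.Gamma_pos_of_pos (by linarith)))
    (Real.Gamma_pos_of_pos (by linarith))

theorem integral_muCauchy {β : ℝ} (hβ : 1 / 2 < β) (φ : ℝ → ℝ) :
    ∫ x, φ x ∂(muCauchy β) = (∫ x, (1 + x ^ 2) ^ (-β) * φ x) / Zcauchy β := by
  have hZ := Zcauchy_pos hβ
  rw [muCauchy, integral_withDensity_eq_integral_toReal_smul (by fun_prop)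
    (Filter.Eventually.of_forall fun x => ENNReal.ofReal_lt_top), ← integral_div]
  refine integral_congr_ae (Filter.Eventually.of_forall fun x => ?_)
  simp only [smul_eq_mul]
  rw [ENNReal.toReal_ofReal (by positivity)]
  ring

theorem isProbabilityMeasure_muCauchy {β : ℝ} (hβ : 1 / 2 < β) :
    IsProbabilityMeasure (muCauchy β) := by
  have hZ := Zcauchy_pos hβ
  constructor
  rw [muCauchy, withDensity_apply _ MeasurableSet.univ, Measure.restrict_univ,
    ← ofReal_integral_eq_lintegral_ofReal ((integrable_one_add_sq_rpow_neg hβ).div_const _)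
      (Filter.Eventually.of_forall fun x => by positivity),
    integral_div, integral_one_add_sq_rpow_neg hβ, div_self hZ.ne', ENNReal.ofReal_one]

theorem varMu_le_integral_sub_sq {μ : Measure ℝ} [IsProbabilityMeasure μ] {f : ℝ → ℝ}
    (hf : Integrable f μ) (hf2 : Integrable (fun x => f x ^ 2) μ) (c : ℝ) :
    varMu μ f ≤ ∫ x, (f x - c) ^ 2 ∂μ := by
  have h : ∫ x, (f x - c) ^ 2 ∂μ
      = (∫ x, f x ^ 2 ∂μ) - 2 * c * (∫ x, f x ∂μ) + c ^ 2 := by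
    have h1 : ∀ x, (f x - c) ^ 2 = f x ^ 2 - 2 * c * f x + c ^ 2 := fun x => by ring
    simp_rw [h1]
    rw [integral_add (f := fun x => f x ^ 2 - 2 * c * f x) (hf2.sub (hf.const_mul _))
        (integrable_const _),
      integral_sub hf2 (hf.const_mul _), integral_const_mul]
    simp
  rw [varMu, h]
  nlinarith [sq_nonneg ((∫ x, f x ∂μ) - c)]

/-- Cauchy–Schwarz on the interval between `0` and `x`, valid for both signs of `x`. -/
theorem sub_sq_le_mul_integral_deriv_sq {f : ℝ → ℝ} (hf : ContDiff ℝ 1 f) (x : ℝ) :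
    (f x - f 0) ^ 2 ≤ x * ∫ t in (0 : ℝ)..x, deriv f t ^ 2 := by
  have hc : Continuous (deriv f) := hf.continuous_deriv le_rfl
  have hi : ∀ g : ℝ → ℝ, Continuous g → IntervalIntegrable g volume 0 x :=
    fun g hg => hg.intervalIntegrable _ _
  set F := ∫ t in (0 : ℝ)..x, deriv f t ^ 2 with hF
  set d := f x - f 0 with hd
  have hd' : ∫ t in (0 : ℝ)..x, deriv f t = d :=
    intervalIntegral.integral_deriv_eq_sub
      (fun t _ => (hf.differentiable one_ne_zero).differentiableAt) (hi _ hc)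
  have key : ∫ t in (0 : ℝ)..x, (x * deriv f t - d) ^ 2 = x * (x * F - d ^ 2) := by
    have h1 : ∀ t, (x * deriv f t - d) ^ 2
        = x ^ 2 * deriv f t ^ 2 - 2 * x * d * deriv f t + d ^ 2 := fun t => by ring
    simp_rw [h1]
    rw [intervalIntegral.integral_add (hi _ (by fun_prop)) (hi _ (by fun_prop)),
      intervalIntegral.integral_sub (hi _ (by fun_prop)) (hi _ (by fun_prop)),
      intervalIntegral.integral_const_mul, intervalIntegral.integral_const_mul, hd',
      intervalIntegral.integral_const, smul_eq_mul, ← hF]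
    ring
  rcases lt_trichotomy x 0 with hx | hx | hx
  · have h := intervalIntegral.integral_nonneg hx.le (μ := volume)
      (fun t _ => sq_nonneg (x * deriv f t - d))
    rw [intervalIntegral.integral_symm, key] at h
    nlinarith
  · simp [hd, hx]
  · have h := intervalIntegral.integral_nonneg hx.le (μ := volume)
      (fun t _ => sq_nonneg (x * deriv f t - d))
    rw [key] at h
    nlinarith

theorem hasDerivAt_one_add_sq_rpow (a x : ℝ) :
    HasDerivAt (fun x : ℝ => (1 + x ^ 2) ^ (1 - a)) (-(2 * (a - 1)) * (x * (1 + x ^ 2) ^ (-a))) x := by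
  have h : HasDerivAt (fun x : ℝ => 1 + x ^ 2) (2 * x) x := by
    simpa using (hasDerivAt_pow 2 x).const_add 1
  convert h.rpow_const (p := 1 - a) (Or.inl (by positivity)) using 1
  rw [show 1 - a - 1 = -a by ring]
  ring

/-- The sharp weighted Poincaré inequality, centred at the value at the origin. -/
theorem two_mul_integral_sub_sq_le {β : ℝ} (hβ : 3 / 2 < β) {f : ℝ → ℝ} (hf : ContDiff ℝ 1 f)
    (hs : HasCompactSupport f) :
    2 * (β - 1) * ∫ x, (1 + x ^ 2) ^ (-β) * (f x - f 0) ^ 2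
      ≤ ∫ x, (1 + x ^ 2) ^ (-β) * ((1 + x ^ 2) * deriv f x ^ 2) := by
  have hc : Continuous (deriv f) := hf.continuous_deriv le_rfl
  have hc2 : Continuous (fun x => deriv f x ^ 2) := by fun_prop
  have hs2 : HasCompactSupport (fun x => deriv f x ^ 2) :=
    hs.deriv.comp_left (g := fun y : ℝ => y ^ 2) (by simp)
  have hcw : ∀ a : ℝ, Continuous (fun x : ℝ => (1 + x ^ 2) ^ a) := fun a =>
    Continuous.rpow_const (by fun_prop) (fun x => Or.inl (by positivity))
  set F : ℝ → ℝ := fun x => ∫ t in (0 : ℝ)..x, deriv f t ^ 2 with hF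
  have hFd : ∀ x, HasDerivAt F (deriv f x ^ 2) x := fun x =>
    intervalIntegral.integral_hasDerivAt_right (hc2.intervalIntegrable _ _)
      (hc2.stronglyMeasurableAtFilter _ _) hc2.continuousAt
  have hFc : Continuous F := continuous_iff_continuousAt.2 fun x => (hFd x).continuousAt
  have hFb : ∀ x, ‖F x‖ ≤ ∫ t, ‖deriv f t ^ 2‖ := fun x =>
    (intervalIntegral.norm_integral_le_integral_norm_uIoc).trans
      (setIntegral_le_integral (hc2.integrable_of_hasCompactSupport hs2).norm
        (Filter.Eventually.of_forall fun t => norm_nonneg _))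
  have hWi : Integrable (fun x : ℝ => (1 + x ^ 2) ^ (1 - β)) := by
    simpa using integrable_one_add_sq_rpow_neg (a := β - 1) (by linarith)
  have hsplit : ∀ x : ℝ, (1 + x ^ 2) ^ (1 - β) = (1 + x ^ 2) ^ (-β) * (1 + x ^ 2) := fun x => by
    rw [show 1 - β = -β + 1 by ring, Real.rpow_add_one (by positivity)]
  have hxWi : Integrable (fun x : ℝ => x * (1 + x ^ 2) ^ (-β)) := by
    refine hWi.mono' (continuous_id.mul (hcw _)).aestronglyMeasurable
      (Filter.Eventually.of_forall fun x => ?_)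
    have hw : (0 : ℝ) ≤ (1 + x ^ 2) ^ (-β) := by positivity
    rw [norm_mul, Real.norm_of_nonneg hw, hsplit, mul_comm]
    refine mul_le_mul_of_nonneg_left ?_ hw
    rw [Real.norm_eq_abs, ← sq_abs]
    nlinarith [sq_nonneg (|x| - 1), abs_nonneg x]
  have hFx : Integrable (fun x : ℝ => F x * (x * (1 + x ^ 2) ^ (-β))) :=
    hxWi.bdd_mul hFc.aestronglyMeasurable (Filter.Eventually.of_forall hFb)
  have hparts := integral_mul_deriv_eq_deriv_mul_of_integrable
    (u := F) (v := fun x : ℝ => (1 + x ^ 2) ^ (1 - β)) (u' := fun x => deriv f x ^ 2)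
    (v' := fun x => -(2 * (β - 1)) * (x * (1 + x ^ 2) ^ (-β)))
    (fun x _ => hFd x) (fun x _ => hasDerivAt_one_add_sq_rpow β x)
    ((hxWi.const_mul _).bdd_mul hFc.aestronglyMeasurable (Filter.Eventually.of_forall hFb))
    ((hc2.mul (hcw _)).integrable_of_hasCompactSupport hs2.mul_right)
    (hWi.bdd_mul hFc.aestronglyMeasurable (Filter.Eventually.of_forall hFb))
  have hr : ∫ x, (1 + x ^ 2) ^ (-β) * ((1 + x ^ 2) * deriv f x ^ 2)
      = 2 * (β - 1) * ∫ x, F x * (x * (1 + x ^ 2) ^ (-β)) := by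
    have h1 : ∀ x : ℝ, F x * (-(2 * (β - 1)) * (x * (1 + x ^ 2) ^ (-β)))
        = -(2 * (β - 1)) * (F x * (x * (1 + x ^ 2) ^ (-β))) := fun x => by ring
    have h2 : ∀ x : ℝ, (1 + x ^ 2) ^ (-β) * ((1 + x ^ 2) * deriv f x ^ 2)
        = deriv f x ^ 2 * (1 + x ^ 2) ^ (1 - β) := fun x => by rw [hsplit]; ring
    simp_rw [h1] at hparts
    rw [integral_const_mul] at hparts
    simp_rw [h2]
    linarith
  rw [hr]
  refine mul_le_mul_of_nonneg_left ?_ (by linarith)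
  refine integral_mono_of_nonneg (Filter.Eventually.of_forall fun x => by positivity) hFx
    (Filter.Eventually.of_forall fun x => ?_)
  have hw : (0 : ℝ) ≤ (1 + x ^ 2) ^ (-β) := by positivity
  have := mul_le_mul_of_nonneg_left (sub_sq_le_mul_integral_deriv_sq hf x) hw
  calc _ ≤ _ := this
    _ = _ := by simp only [hF]; ring

/-- Weighted Poincaré inequality for generalized Cauchy measures, `β > 3/2`: for the
diffusion with `σ(x) = √(1+x²)`, the potential `V_σ(x) = (2β−1)/(1+x²)` is positive and
`λ₁ ≥ (2β−1)(β−3/2)/(β−1)`. -/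
theorem poincare_generalized_cauchy (β : ℝ) (hβ : 3 / 2 < β) :
    (∀ x : ℝ, 0 < (2 * β - 1) / (1 + x ^ 2))
    ∧ ∀ f : ℝ → ℝ, ContDiff ℝ (⊤ : ℕ∞) f → HasCompactSupport f →
        (2 * β - 1) * (β - 3 / 2) / (β - 1) * varMu (muCauchy β) f
          ≤ ∫ x, (1 + x ^ 2) * deriv f x ^ 2 ∂(muCauchy β) := by
  have hβ' : 1 / 2 < β := by linarith
  refine ⟨fun x => div_pos (by linarith) (by positivity), fun f hf hs => ?_⟩
  have hf1 : ContDiff ℝ 1 f := contDiff_infty.1 hf 1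
  have hprob := isProbabilityMeasure_muCauchy hβ'
  have hZ := Zcauchy_pos hβ'
  have hc2 : Continuous (fun x => f x ^ 2) := hf1.continuous.pow 2
  have hs2 : HasCompactSupport (fun x => f x ^ 2) :=
    hs.comp_left (g := fun y : ℝ => y ^ 2) (by simp)
  have hvar : varMu (muCauchy β) f ≤ ∫ x, (f x - f 0) ^ 2 ∂(muCauchy β) :=
    varMu_le_integral_sub_sq (hf1.continuous.integrable_of_hasCompactSupport hs)
      (hc2.integrable_of_hasCompactSupport hs2) (f 0)
  have hC : (2 * β - 1) * (β - 3 / 2) / (β - 1) ≤ 2 * (β - 1) := by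
    rw [div_le_iff₀ (by linarith)]
    nlinarith
  have hC0 : 0 ≤ (2 * β - 1) * (β - 3 / 2) / (β - 1) :=
    div_nonneg (mul_nonneg (by linarith) (by linarith)) (by linarith)
  calc (2 * β - 1) * (β - 3 / 2) / (β - 1) * varMu (muCauchy β) f
      ≤ (2 * β - 1) * (β - 3 / 2) / (β - 1) * ∫ x, (f x - f 0) ^ 2 ∂(muCauchy β) :=
        mul_le_mul_of_nonneg_left hvar hC0
    _ ≤ 2 * (β - 1) * ∫ x, (f x - f 0) ^ 2 ∂(muCauchy β) :=
        mul_le_mul_of_nonneg_right hC (integral_nonneg fun x => sq_nonneg _)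
    _ ≤ ∫ x, (1 + x ^ 2) * deriv f x ^ 2 ∂(muCauchy β) := by
        have h := div_le_div_of_nonneg_right (two_mul_integral_sub_sq_le hβ hf1 hs) hZ.le
        rwa [mul_div_assoc, ← integral_muCauchy hβ' (fun x => (f x - f 0) ^ 2),
          ← integral_muCauchy hβ' (fun x => (1 + x ^ 2) * deriv f x ^ 2)] at h
end
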